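/- arXiv:0707.2186 — 7 statements merged into one kernel-verified Lean document; each statement's English description precedes it below -/
import Mathlib

section
/- Let η be a finite Borel measure on ℝ and let e(η) := e^{−η(ℝ)} ∑_{n=0}^∞ η^{∗n}/n! be the associated compound Poisson probability measure on ℝ. Then for every ℓ ∈ ℤ, the ℓ-th Fourier coefficient of the pushforward of e(η) under the map x ↦ e^{ix} from ℝ to the circle group 𝕋 equals exp(∫_ℝ (e^{iℓx} − 1) dη(x)). -/
open MeasureTheory Real Complex ENNReal

noncomputable instance : MeasurableSpace Circle := borel Circle
instance : BorelSpace Circle := ⟨rfl⟩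

/-- `n`-fold additive convolution power of a measure, with `μ^{∗0} = δ_0`. -/
noncomputable def convPow {G : Type*} [AddMonoid G] [MeasurableSpace G]
    (μ : Measure G) : ℕ → Measure G
  | 0 => Measure.dirac 0
  | n + 1 => (convPow μ n).conv μ

/-- The compound Poisson measure `e(η) = e^{−η(G)} ∑_{n=0}^∞ η^{∗n}/n!` associated to a finite
measure `η` on an abelian topological group `G`. -/
noncomputable def cPoisson {G : Type*} [AddMonoid G] [MeasurableSpace G]
    (η : Measure G) : Measure G :=
  Measure.sum fun n : ℕ =>
    (ENNReal.ofReal (Real.exp (-(η Set.univ).toReal)) / (n.factorial : ℝ≥0∞)) • convPow η n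

instance isFiniteMeasure_convPow {G : Type*} [AddMonoid G] [MeasurableSpace G]
    (μ : Measure G) [IsFiniteMeasure μ] (n : ℕ) : IsFiniteMeasure (convPow μ n) := by
  induction n with
  | zero => rw [convPow]; infer_instance
  | succ n ih => rw [convPow]; infer_instance

lemma charFun_convPow (μ : Measure ℝ) [IsFiniteMeasure μ] (n : ℕ) (t : ℝ) :
    charFun (convPow μ n) t = charFun μ t ^ n := by
  induction n with
  | zero => simp [convPow]
  | succ n ih => rw [convPow, charFun_conv, ih, pow_succ]

lemma convPow_univ {G : Type*} [AddMonoid G] [MeasurableSpace G] [MeasurableAdd₂ G]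
    (μ : Measure G) [IsFiniteMeasure μ] (n : ℕ) :
    convPow μ n Set.univ = μ Set.univ ^ n := by
  induction n with
  | zero => simp [convPow]
  | succ n ih =>
    rw [convPow, Measure.conv, Measure.map_apply measurable_add MeasurableSet.univ,
      Set.preimage_univ, ← Set.univ_prod_univ, Measure.prod_prod, ih, pow_succ]

/-- The real value of the weights in `cPoisson`. -/
lemma cPoisson_weight_toReal (c : ℝ) (n : ℕ) :
    (ENNReal.ofReal (Real.exp c) / (n.factorial : ℝ≥0∞)).toReal = Real.exp c / n.factorial := by
  rw [ENNReal.toReal_div, ENNReal.toReal_ofReal (Real.exp_pos c).le, ENNReal.toReal_natCast]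

instance isFiniteMeasure_cPoisson {G : Type*} [AddMonoid G] [MeasurableSpace G]
    [MeasurableAdd₂ G] (μ : Measure G) [IsFiniteMeasure μ] : IsFiniteMeasure (cPoisson μ) := by
  have h : ∀ n : ℕ, ENNReal.ofReal (Real.exp (-(μ Set.univ).toReal)) / (n.factorial : ℝ≥0∞) *
      μ Set.univ ^ n = ENNReal.ofReal (Real.exp (-(μ Set.univ).toReal) *
        ((μ Set.univ).toReal ^ n / n.factorial)) := fun n => by
    have hn : (0 : ℝ) < n.factorial := by positivity
    rw [ENNReal.ofReal_mul (Real.exp_pos _).le, ENNReal.ofReal_div_of_pos hn,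
      ENNReal.ofReal_natCast, ENNReal.ofReal_pow ENNReal.toReal_nonneg,
      ENNReal.ofReal_toReal (measure_ne_top μ _)]
    simp only [div_eq_mul_inv]
    ring
  refine ⟨?_⟩
  rw [cPoisson, Measure.sum_apply _ MeasurableSet.univ]
  simp only [Measure.smul_apply, smul_eq_mul, convPow_univ, h]
  exact ((Real.summable_pow_div_factorial _).mul_left _).tsum_ofReal_lt_top

lemma charFun_cPoisson (μ : Measure ℝ) [IsFiniteMeasure μ] (t : ℝ) :
    charFun (cPoisson μ) t = Complex.exp (charFun μ t - μ.real Set.univ) := by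
  have hint : Integrable (fun x : ℝ => Complex.exp (t * x * Complex.I)) (cPoisson μ) := by
    refine Integrable.of_bound (by fun_prop) 1 (Filter.Eventually.of_forall fun x => ?_)
    rw [← Complex.ofReal_mul, Complex.norm_exp_ofReal_mul_I]
  rw [charFun_apply_real]
  refine (hasSum_integral_measure hint).unique ?_
  simp only [integral_smul_measure, ← charFun_apply_real, charFun_convPow, cPoisson_weight_toReal]
  rw [sub_eq_neg_add, Complex.exp_add]
  convert! (NormedSpace.expSeries_div_hasSum_exp (charFun μ t)).mul_left
    (Complex.exp (-(μ.real Set.univ : ℂ))) using 1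
  · ext n
    rw [Complex.real_smul]
    simp only [Measure.real]
    push_cast
    ring
  · rw [Complex.exp_eq_exp_ℂ]

/-- For a finite Borel measure `η` on `ℝ`, the `ℓ`-th Fourier coefficient of the pushforward of
the compound Poisson measure `e(η)` under `x ↦ e^{ix}` equals `exp (∫ (e^{iℓx} − 1) dη(x))`. -/
theorem stmt3 (η : Measure ℝ) [IsFiniteMeasure η] :
    ∀ ℓ : ℤ, (∫ z : Circle, (z : ℂ) ^ ℓ ∂(Measure.map (fun x : ℝ => Circle.exp x) (cPoisson η)))
      = Complex.exp (∫ x : ℝ, (Complex.exp (Complex.I * ℓ * x) - 1) ∂η) := by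
  intro ℓ
  have hexp : Measurable (fun x : ℝ => Circle.exp x) := Circle.exp.continuous.measurable
  have hpow : Continuous (fun z : Circle => (z : ℂ) ^ ℓ) :=
    continuous_subtype_val.zpow₀ ℓ fun z => Or.inl (Circle.coe_ne_zero z)
  have hchar : Integrable (fun x : ℝ => Complex.exp (Complex.I * ℓ * x)) η := by
    refine Integrable.of_bound (by fun_prop) 1 (Filter.Eventually.of_forall fun x => ?_)
    rw [show Complex.I * ℓ * x = ((ℓ * x : ℝ) : ℂ) * Complex.I by push_cast; ring,
      Complex.norm_exp_ofReal_mul_I]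
  rw [integral_map hexp.aemeasurable hpow.measurable.aestronglyMeasurable,
    integral_sub hchar (integrable_const 1), integral_const]
  have hcoe : ∀ x : ℝ, (Circle.exp x : ℂ) ^ ℓ = Complex.exp ((ℓ : ℝ) * x * Complex.I) :=
    fun x => by
      rw [Circle.coe_exp, ← Complex.exp_int_mul]
      push_cast
      ring_nf
  have hcomm : ∀ x : ℝ, Complex.I * ℓ * x = (ℓ : ℝ) * x * Complex.I := fun x => by
    push_cast
    ring
  simp only [hcoe, hcomm]
  rw [← charFun_apply_real, ← charFun_apply_real, charFun_cPoisson, Complex.real_smul, mul_one]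
end

section
/- Let η be a Borel measure on the circle group 𝕋 with values in [0, ∞] such that η({1}) = 0. Then η is a Lévy measure on 𝕋 (i.e., η(𝕋 ∖ U) < ∞ for every Borel neighbourhood U of 1 and ∫_𝕋 (1 − Re z^ℓ) dη(z) < ∞ for every ℓ ∈ ℤ) if and only if ∫_𝕋 (arg z)² dη(z) < ∞. -/
open MeasureTheory Real Complex ENNReal

theorem Circle.re_zpow_eq_cos_mul_arg (z : Circle) (ℓ : ℤ) :
    ((z : ℂ) ^ ℓ).re = Real.cos (ℓ * Complex.arg (z : ℂ)) := by
  conv_lhs => rw [← Circle.exp_arg z, ← Circle.coe_zpow, ← Circle.exp_zsmul, Circle.coe_exp,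
    Complex.exp_ofReal_mul_I_re, zsmul_eq_mul]

theorem Circle.sq_arg_le (z : Circle) :
    Complex.arg (z : ℂ) ^ 2 ≤ π ^ 2 / 2 * (1 - ((z : ℂ) ^ (1 : ℤ)).re) := by
  rw [Circle.re_zpow_eq_cos_mul_arg, Int.cast_one, one_mul]
  have h := Real.cos_le_one_sub_mul_cos_sq (Complex.abs_arg_le_pi (z : ℂ))
  calc Complex.arg (z : ℂ) ^ 2 = π ^ 2 / 2 * (2 / π ^ 2 * Complex.arg (z : ℂ) ^ 2) := by
        field_simp
    _ ≤ π ^ 2 / 2 * (1 - Real.cos (Complex.arg (z : ℂ))) := by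
        gcongr
        linarith

theorem Circle.one_sub_re_zpow_le (z : Circle) (ℓ : ℤ) :
    1 - ((z : ℂ) ^ ℓ).re ≤ (ℓ : ℝ) ^ 2 / 2 * Complex.arg (z : ℂ) ^ 2 := by
  rw [Circle.re_zpow_eq_cos_mul_arg]
  have h := Real.one_sub_sq_div_two_le_cos (x := ℓ * Complex.arg (z : ℂ))
  rw [mul_pow] at h
  linarith

theorem Circle.exists_sq_le_sq_arg_of_notMem {U : Set Circle} (hU : U ∈ nhds (1 : Circle)) :
    ∃ δ > 0, ∀ z ∉ U, δ ^ 2 ≤ Complex.arg (z : ℂ) ^ 2 := by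
  have h : Circle.exp ⁻¹' U ∈ nhds (0 : ℝ) :=
    Circle.exp.continuous.continuousAt.preimage_mem_nhds (by rwa [Circle.exp_zero])
  obtain ⟨δ, hδ, hball⟩ := Metric.mem_nhds_iff.mp h
  refine ⟨δ, hδ, fun z hz ↦ ?_⟩
  by_contra! hlt
  refine hz ?_
  rw [← Circle.exp_arg z]
  exact hball (by simpa using abs_lt_of_sq_lt_sq hlt hδ.le)

theorem lintegral_ofReal_lt_top_of_le_const_mul {α : Type*} [MeasurableSpace α] {μ : Measure α}
    {f g : α → ℝ} {c : ℝ} (hc : 0 ≤ c) (hfg : ∀ x, f x ≤ c * g x)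
    (hg : ∫⁻ x, ENNReal.ofReal (g x) ∂μ < ⊤) : ∫⁻ x, ENNReal.ofReal (f x) ∂μ < ⊤ := by
  calc ∫⁻ x, ENNReal.ofReal (f x) ∂μ
      ≤ ∫⁻ x, ENNReal.ofReal c * ENNReal.ofReal (g x) ∂μ :=
        lintegral_mono fun x ↦ (ENNReal.ofReal_le_ofReal (hfg x)).trans_eq (ENNReal.ofReal_mul hc)
    _ = ENNReal.ofReal c * ∫⁻ x, ENNReal.ofReal (g x) ∂μ :=
        lintegral_const_mul' _ _ ENNReal.ofReal_ne_top
    _ < ⊤ := ENNReal.mul_lt_top ENNReal.ofReal_lt_top hg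

/-- A `[0,∞]`-valued Borel measure `η` on the circle group `𝕋` with `η({1}) = 0` is a Lévy
measure (i.e. `η(𝕋 ∖ U) < ∞` for every Borel neighbourhood `U` of `1`, and
`∫ (1 − Re z^ℓ) dη < ∞` for every character `z ↦ z^ℓ`) if and only if
`∫ (arg z)² dη(z) < ∞`. -/
theorem stmt7 (η : Measure Circle) (hη1 : η {1} = 0) :
    ((∀ U : Set Circle, MeasurableSet U → U ∈ nhds (1 : Circle) → η Uᶜ < ⊤) ∧
      (∀ ℓ : ℤ, ∫⁻ z : Circle, ENNReal.ofReal (1 - ((z : ℂ) ^ ℓ).re) ∂η < ⊤)) ↔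
    ∫⁻ z : Circle, ENNReal.ofReal ((Complex.arg (z : ℂ)) ^ 2) ∂η < ⊤ := by
  constructor
  · rintro ⟨-, h⟩
    exact lintegral_ofReal_lt_top_of_le_const_mul (by positivity) Circle.sq_arg_le (h 1)
  · intro h
    refine ⟨fun U _ hU ↦ ?_, fun ℓ ↦ lintegral_ofReal_lt_top_of_le_const_mul (by positivity)
      (fun z ↦ Circle.one_sub_re_zpow_le z ℓ) h⟩
    obtain ⟨δ, hδ, hle⟩ := Circle.exists_sq_le_sq_arg_of_notMem hU
    have hmeas : Measurable fun z : Circle ↦ ENNReal.ofReal (Complex.arg (z : ℂ) ^ 2) :=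
      ((Complex.measurable_arg.comp (Continuous.measurable (by fun_prop))).pow_const 2).ennreal_ofReal
    calc η Uᶜ ≤ η {z : Circle | ENNReal.ofReal (δ ^ 2) ≤
          ENNReal.ofReal (Complex.arg (z : ℂ) ^ 2)} :=
          measure_mono fun z hz ↦ ENNReal.ofReal_le_ofReal (hle z hz)
      _ < ⊤ := meas_ge_le_lintegral_div hmeas.aemeasurable
          (ENNReal.ofReal_pos.mpr (by positivity)).ne' ENNReal.ofReal_ne_top |>.trans_lt
          (ENNReal.div_lt_top h.ne (ENNReal.ofReal_pos.mpr (by positivity)).ne')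
end

section
/- Let p be a prime. There is no Borel probability measure μ on the p-adic integers ℤ_p such that the p-fold convolution power μ^{∗p} equals the Dirac measure δ_1 at 1 ∈ ℤ_p. Consequently, the Dirac measure δ_1 on ℤ_p is not infinitely divisible (while it is trivially weakly infinitely divisible), so on ℤ_p the class of infinitely divisible measures is strictly smaller than the class of weakly infinitely divisible measures. -/
open MeasureTheory

variable {p : ℕ}

noncomputable instance [Fact p.Prime] : MeasurableSpace ℤ_[p] := borel ℤ_[p]
instance [Fact p.Prime] : BorelSpace ℤ_[p] := ⟨rfl⟩

theorem MeasureTheory.Measure.exists_eq_dirac_of_conv_eq_dirac {G : Type*} [AddGroup G]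
    [MeasurableSpace G] [MeasurableAdd₂ G] [MeasurableSingletonClass G] {μ ν : Measure G}
    [IsProbabilityMeasure μ] [IsProbabilityMeasure ν] {a : G}
    (h : μ.conv ν = Measure.dirac a) : ∃ y, ν = Measure.dirac y := by
  have hae : ∀ᵐ z ∂(μ.conv ν), z = a := by
    rw [h, ae_dirac_eq]
    rfl
  have hprod : ∀ᵐ z ∂(μ.prod ν), z.1 + z.2 = a :=
    ae_of_ae_map (measurable_fst.add measurable_snd).aemeasurable hae
  obtain ⟨x, hx⟩ := (Measure.ae_ae_of_ae_prod hprod).exists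
  refine ⟨-x + a, ?_⟩
  have hid : (id : G → G) =ᵐ[ν] fun _ => -x + a := by
    filter_upwards [hx] with y hy
    simp [← hy]
  simpa [Measure.map_const] using Measure.map_congr hid

theorem isProbabilityMeasure_convPow {G : Type*} [AddMonoid G] [MeasurableSpace G]
    [MeasurableAdd₂ G] (μ : Measure G) [IsProbabilityMeasure μ] (n : ℕ) :
    IsProbabilityMeasure (convPow μ n) := by
  induction n with
  | zero => exact Measure.dirac.isProbabilityMeasure
  | succ n ih => exact Measure.probabilitymeasure_of_probabilitymeasures_conv _ _

theorem convPow_dirac {G : Type*} [AddMonoid G] [MeasurableSpace G]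
    [MeasurableAdd₂ G] (y : G) (n : ℕ) :
    convPow (Measure.dirac y) n = Measure.dirac (n • y) := by
  induction n with
  | zero => simp [convPow]
  | succ n ih => rw [convPow, ih, Measure.dirac_conv_dirac, succ_nsmul]

theorem convPow_ne_dirac_one [Fact p.Prime] (μ : Measure ℤ_[p]) [IsProbabilityMeasure μ] :
    convPow μ p ≠ Measure.dirac 1 := by
  intro h
  obtain ⟨n, hn⟩ := Nat.exists_eq_succ_of_ne_zero (Fact.out : p.Prime).ne_zero
  have := isProbabilityMeasure_convPow μ n
  have hconv : (convPow μ n).conv μ = Measure.dirac 1 :=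
    (congrArg (convPow μ) hn).symm.trans h
  obtain ⟨y, rfl⟩ := Measure.exists_eq_dirac_of_conv_eq_dirac hconv
  rw [convPow_dirac, dirac_eq_dirac_iff, nsmul_eq_mul] at h
  exact PadicInt.prime_p.not_isUnit (.of_mul_eq_one y h)

/-- There is no Borel probability measure `μ` on `ℤ_p` with `μ^{∗p} = δ_1`; consequently the
Dirac measure `δ_1` on `ℤ_p` is not infinitely divisible (while it is trivially weakly
infinitely divisible), so on `ℤ_p` the infinitely divisible measures form a strictly smaller
class than the weakly infinitely divisible ones. -/
theorem stmt10 [Fact p.Prime] :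
    (¬ ∃ (μ : Measure ℤ_[p]) (_ : IsProbabilityMeasure μ),
        convPow μ p = Measure.dirac (1 : ℤ_[p])) ∧
    (¬ ∀ n : ℕ, 1 ≤ n → ∃ (μn : Measure ℤ_[p]) (_ : IsProbabilityMeasure μn),
        Measure.dirac (1 : ℤ_[p]) = convPow μn n) ∧
    (∀ n : ℕ, 1 ≤ n → ∃ (μn : Measure ℤ_[p]) (_ : IsProbabilityMeasure μn) (xn : ℤ_[p]),
        Measure.dirac (1 : ℤ_[p]) = (convPow μn n).conv (Measure.dirac xn)) := by
  refine ⟨?_, ?_, fun n _ => ⟨Measure.dirac 0, inferInstance, 1, ?_⟩⟩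
  · rintro ⟨μ, _, h⟩
    exact convPow_ne_dirac_one μ h
  · intro h
    obtain ⟨μ, _, hμ⟩ := h p (Fact.out : p.Prime).one_le
    exact convPow_ne_dirac_one μ hμ.symm
  · rw [convPow_dirac, Measure.dirac_conv_dirac, smul_zero, zero_add]
end

section
/- Let p be a prime and let η be a Borel measure on ℤ_p with values in [0, ∞] such that η({0}) = 0 and η(ℤ_p ∖ p^r ℤ_p) < ∞ for every integer r ≥ 0. Then for every continuous character χ of ℤ_p, ∫_{ℤ_p} (1 − Re χ(x)) dη(x) < ∞. Hence a measure η on ℤ_p with η({0}) = 0 is a Lévy measure if and only if η(ℤ_p ∖ p^r ℤ_p) < ∞ for all r ≥ 0. -/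
open MeasureTheory Real Complex ENNReal

variable {p : ℕ} [Fact p.Prime]

noncomputable instance : MeasurableSpace ℤ_[p] := borel ℤ_[p]
instance : BorelSpace ℤ_[p] := ⟨rfl⟩

/-- The circle has no small subgroups: a point whose iterated squares all stay within distance
`1 / 2` of `1` is `1`. -/
lemma Circle.eq_one_of_forall_norm_pow_two_pow_sub_one_le (z : Circle)
    (h : ∀ k : ℕ, ‖((z : ℂ)) ^ 2 ^ k - 1‖ ≤ 1 / 2) : z = 1 := by
  have key : ∀ k : ℕ, (3 / 2 : ℝ) ^ k * ‖(z : ℂ) - 1‖ ≤ ‖((z : ℂ)) ^ 2 ^ k - 1‖ := by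
    intro k
    induction k with
    | zero => simp
    | succ k ih =>
      set w : ℂ := (z : ℂ) ^ 2 ^ k with hw
      have hfac : (z : ℂ) ^ 2 ^ (k + 1) - 1 = (w + 1) * (w - 1) := by
        rw [hw, pow_succ 2 k, pow_mul]; ring
      have hplus : 3 / 2 ≤ ‖w + 1‖ := by
        have htri : ‖(2 : ℂ)‖ ≤ ‖w + 1‖ + ‖w - 1‖ := by
          have := norm_sub_le (w + 1) (w - 1)
          rwa [show w + 1 - (w - 1) = 2 by ring] at this
        rw [Complex.norm_ofNat] at htri
        linarith [h k]
      rw [hfac, norm_mul, pow_succ', mul_assoc]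
      gcongr
  by_contra hz
  have hpos : 0 < ‖(z : ℂ) - 1‖ :=
    norm_pos_iff.mpr (sub_ne_zero.mpr fun h1 => hz (Circle.ext (by simpa using h1)))
  obtain ⟨k, hk⟩ := pow_unbounded_of_one_lt (1 / 2 / ‖(z : ℂ) - 1‖)
    (show (1 : ℝ) < 3 / 2 by norm_num)
  rw [div_lt_iff₀ hpos] at hk
  linarith [key k, h k]

/-- Divisibility by `p ^ r` is a norm condition. -/
lemma PadicInt.setOf_pow_dvd_eq_closedBall (r : ℕ) :
    {x : ℤ_[p] | (p : ℤ_[p]) ^ r ∣ x} = Metric.closedBall 0 ((p : ℝ) ^ (-r : ℤ)) := by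
  ext x
  rw [mem_closedBall_zero_iff, PadicInt.norm_le_pow_iff_mem_span_pow, Ideal.mem_span_singleton]
  rfl

/-- The subgroups `p ^ r ℤ_p` form a neighbourhood basis of `0`. -/
lemma PadicInt.exists_setOf_pow_dvd_subset {U : Set ℤ_[p]} (hU : U ∈ nhds (0 : ℤ_[p])) :
    ∃ r : ℕ, {x : ℤ_[p] | (p : ℤ_[p]) ^ r ∣ x} ⊆ U := by
  obtain ⟨ε, hε, hball⟩ := Metric.mem_nhds_iff.mp hU
  obtain ⟨r, hr⟩ := PadicInt.exists_pow_neg_lt p hε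
  refine ⟨r, ?_⟩
  rw [PadicInt.setOf_pow_dvd_eq_closedBall]
  exact (Metric.closedBall_subset_ball hr).trans hball

/-- A continuous character of `ℤ_p` is trivial on some `p ^ r ℤ_p`. -/
lemma PadicInt.exists_character_eq_one (χ : ℤ_[p] → Circle) (hχ : Continuous χ)
    (hadd : ∀ x y : ℤ_[p], χ (x + y) = χ x * χ y) :
    ∃ r : ℕ, ∀ x : ℤ_[p], (p : ℤ_[p]) ^ r ∣ x → χ x = 1 := by
  have hzero : χ 0 = 1 := by simpa using hadd 0 0
  have hnsmul : ∀ (n : ℕ) (x : ℤ_[p]), χ (n * x) = χ x ^ n := by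
    intro n x
    induction n with
    | zero => simpa using hzero
    | succ n ih => rw [Nat.cast_succ, add_mul, one_mul, hadd, ih, pow_succ]
  have hcont : Continuous fun x => ‖(χ x : ℂ) - 1‖ := by fun_prop
  have hU : {x : ℤ_[p] | ‖(χ x : ℂ) - 1‖ < 1 / 2} ∈ nhds (0 : ℤ_[p]) :=
    (isOpen_lt hcont continuous_const).mem_nhds (by simp [hzero])
  obtain ⟨r, hr⟩ := PadicInt.exists_setOf_pow_dvd_subset hU
  refine ⟨r, fun x hx => Circle.eq_one_of_forall_norm_pow_two_pow_sub_one_le _ fun k => ?_⟩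
  have := hr (show _ ∣ ((2 ^ k : ℕ) : ℤ_[p]) * x from hx.mul_left _)
  rw [Set.mem_ofPred_eq, hnsmul, Circle.coe_pow] at this
  exact this.le

/-- Measures finite off every `p ^ r ℤ_p` integrate `1 - Re χ` for continuous characters `χ`. -/
lemma PadicInt.lintegral_one_sub_re_character_lt_top (η : Measure ℤ_[p])
    (hη : ∀ r : ℕ, η {x : ℤ_[p] | ¬ (p : ℤ_[p]) ^ r ∣ x} < ⊤) (χ : ℤ_[p] → Circle)
    (hχ : Continuous χ) (hadd : ∀ x y : ℤ_[p], χ (x + y) = χ x * χ y) :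
    ∫⁻ x : ℤ_[p], ENNReal.ofReal (1 - ((χ x : ℂ)).re) ∂η < ⊤ := by
  obtain ⟨r, hr⟩ := PadicInt.exists_character_eq_one χ hχ hadd
  set S := {x : ℤ_[p] | ¬ (p : ℤ_[p]) ^ r ∣ x} with hS
  calc ∫⁻ x : ℤ_[p], ENNReal.ofReal (1 - ((χ x : ℂ)).re) ∂η
      ≤ ∫⁻ x, S.indicator (fun _ => (2 : ℝ≥0∞)) x ∂η := by
        refine lintegral_mono fun x => ?_
        by_cases hx : (p : ℤ_[p]) ^ r ∣ x
        · simp [hr x hx]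
        · rw [Set.indicator_of_mem (show x ∈ S from hx)]
          have hre := (abs_le.mp ((Complex.abs_re_le_norm (χ x)).trans_eq (Circle.norm_coe _))).1
          exact ENNReal.ofReal_le_of_le_toReal (by rw [ENNReal.toReal_ofNat]; linarith)
    _ ≤ 2 * η S := lintegral_indicator_const_le _ _
    _ < ⊤ := ENNReal.mul_lt_top (by simp) (hη r)

/-- Let `η` be a `[0,∞]`-valued Borel measure on `ℤ_p` with `η({0}) = 0`. If
`η(ℤ_p ∖ p^r ℤ_p) < ∞` for every `r ≥ 0`, then `∫ (1 − Re χ(x)) dη(x) < ∞` for every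
continuous character `χ` of `ℤ_p`; hence `η` is a Lévy measure if and only if
`η(ℤ_p ∖ p^r ℤ_p) < ∞` for all `r ≥ 0`. -/
theorem stmt11 (η : Measure ℤ_[p]) (hη0 : η {0} = 0) :
    ((∀ r : ℕ, η {x : ℤ_[p] | ¬ (p : ℤ_[p]) ^ r ∣ x} < ⊤) →
      ∀ χ : ℤ_[p] → Circle, Continuous χ → (∀ x y : ℤ_[p], χ (x + y) = χ x * χ y) →
        ∫⁻ x : ℤ_[p], ENNReal.ofReal (1 - ((χ x : ℂ)).re) ∂η < ⊤) ∧
    (((∀ U : Set ℤ_[p], MeasurableSet U → U ∈ nhds (0 : ℤ_[p]) → η Uᶜ < ⊤) ∧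
        (∀ χ : ℤ_[p] → Circle, Continuous χ → (∀ x y : ℤ_[p], χ (x + y) = χ x * χ y) →
          ∫⁻ x : ℤ_[p], ENNReal.ofReal (1 - ((χ x : ℂ)).re) ∂η < ⊤)) ↔
      (∀ r : ℕ, η {x : ℤ_[p] | ¬ (p : ℤ_[p]) ^ r ∣ x} < ⊤)) := by
  have hchar := PadicInt.lintegral_one_sub_re_character_lt_top η
  refine ⟨hchar, fun h r => ?_, fun h => ⟨fun U _ hU => ?_, hchar h⟩⟩
  · have hp : (0 : ℝ) < (p : ℝ) ^ (-r : ℤ) :=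
      zpow_pos (by exact_mod_cast (Fact.out : p.Prime).pos) _
    have hball := PadicInt.setOf_pow_dvd_eq_closedBall (p := p) r
    refine h.1 {x : ℤ_[p] | (p : ℤ_[p]) ^ r ∣ x} ?_ ?_ <;> rw [hball]
    · exact Metric.isClosed_closedBall.measurableSet
    · exact Metric.closedBall_mem_nhds _ hp
  · obtain ⟨r, hr⟩ := PadicInt.exists_setOf_pow_dvd_subset hU
    exact (measure_mono (Set.compl_subset_compl.mpr hr)).trans_lt (h r)
end

section
/- Let p be a prime and let η be a Lévy measure on ℤ_p (i.e., η({0}) = 0 and η(ℤ_p ∖ p^r ℤ_p) < ∞ for all r ≥ 0). For each n ≥ 0 define the finite measure η_{n+1} on ℤ^{n+1} by η_{n+1}({0}) = 0 and η_{n+1}({ℓ}) = η({x ∈ ℤ_p : (x_0, x_1, …, x_n) = ℓ}) for all ℓ ∈ ℤ^{n+1} ∖ {0}, where x_0, x_1, … are the p-adic digits of x. Then the family of compound Poisson measures is compatible: for every n ≥ 0 and every ℓ ∈ ℤ^{n+1}, e(η_{n+2})({ℓ} × ℤ) = e(η_{n+1})({ℓ}). -/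
open MeasureTheory Real ENNReal

variable {p : ℕ} [Fact p.Prime]

/-- The `j`-th digit of the `p`-adic integer `x` in its expansion `x = ∑_j x_j p^j`,
`x_j ∈ {0, …, p−1}`. -/
noncomputable def padicDigit (x : ℤ_[p]) (j : ℕ) : ℤ := ((x.appr (j + 1)) / p ^ j : ℕ)

open Finset in
theorem tsum_sum_antidiagonal_eq_tsum_tsum (f : ℕ → ℕ → ℝ≥0∞) :
    ∑' n, ∑ ij ∈ antidiagonal n, f ij.1 ij.2 = ∑' i, ∑' j, f i j := by
  rw [← ENNReal.tsum_prod, ← HasAntidiagonal.sigmaAntidiagonalEquivProd.tsum_eq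
    (fun ij : ℕ × ℕ ↦ f ij.1 ij.2), ENNReal.tsum_sigma']
  refine tsum_congr fun n ↦ ?_
  rw [← Finset.tsum_subtype (antidiagonal n) (fun ij ↦ f ij.1 ij.2)]
  rfl

theorem ENNReal.tsum_pow_div_factorial {c : ℝ≥0∞} (hc : c ≠ ∞) :
    ∑' n : ℕ, c ^ n / (n.factorial : ℝ≥0∞) = ENNReal.ofReal (Real.exp c.toReal) := by
  rw [Real.exp_eq_exp_ℝ, NormedSpace.exp_eq_tsum_div, ENNReal.ofReal_tsum_of_nonneg
    (fun n ↦ by positivity) (Real.summable_pow_div_factorial _)]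
  refine tsum_congr fun n ↦ ?_
  rw [ENNReal.ofReal_div_of_pos (by positivity), ENNReal.ofReal_pow ENNReal.toReal_nonneg,
    ENNReal.ofReal_toReal hc, ENNReal.ofReal_natCast]

theorem cPoisson_apply {G : Type*} [AddMonoid G] [MeasurableSpace G] (η : Measure G) {s : Set G}
    (hs : MeasurableSet s) :
    cPoisson η s = ∑' n : ℕ,
      ENNReal.ofReal (Real.exp (-(η Set.univ).toReal)) / (n.factorial : ℝ≥0∞) *
        convPow η n s := by
  simp [cPoisson, Measure.sum_apply _ hs]

section CompoundPoisson

variable {G H : Type*} [AddMonoid G] [MeasurableSpace G] [MeasurableAdd₂ G]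
  [AddMonoid H] [MeasurableSpace H] [MeasurableAdd₂ H]

/-- Convolution on the right by an s-finite measure, as a linear endomorphism. -/
noncomputable def convRight (ν : Measure G) [SFinite ν] : Module.End ℝ≥0∞ (Measure G) where
  toFun μ := μ.conv ν
  map_add' μ₁ μ₂ := by
    refine Measure.ext_of_lintegral _ fun f hf ↦ ?_
    simp only [lintegral_add_measure, Measure.lintegral_conv hf]
  map_smul' c μ := Measure.conv_smul_left μ ν c

theorem convPow_eq_convRight_pow (ν : Measure G) [SFinite ν] (n : ℕ) :
    convPow ν n = (convRight ν ^ n) (Measure.dirac 0) := by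
  induction n with
  | zero => rfl
  | succ n ih => rw [pow_succ', Module.End.mul_apply, ← ih]; rfl

theorem convRight_add_smul_dirac_zero (μ : Measure G) [SFinite μ] (c : ℝ≥0∞) :
    convRight (μ + c • Measure.dirac 0) = convRight μ + c • 1 := by
  refine LinearMap.ext fun ρ ↦ Measure.ext_of_lintegral _ fun f hf ↦ ?_
  change ∫⁻ x, f x ∂(ρ.conv (μ + c • Measure.dirac 0)) = ∫⁻ x, f x ∂(ρ.conv μ + c • ρ)
  simp only [lintegral_add_measure, Measure.lintegral_conv hf, lintegral_smul_measure]
  have h : ∀ x, ∫⁻ y, f (x + y) ∂(Measure.dirac (0 : G)) = f x := fun x ↦ by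
    rw [lintegral_dirac' _ (by fun_prop), add_zero]
  simp only [h, smul_eq_mul]
  rw [lintegral_add_right _ (by fun_prop), lintegral_const_mul _ hf]

theorem convPow_add_smul_dirac_zero (μ : Measure G) [SFinite μ] (c : ℝ≥0∞) (n : ℕ) :
    convPow (μ + c • Measure.dirac 0) n =
      ∑ ij ∈ Finset.HasAntidiagonal.antidiagonal n, n.choose ij.1 • c ^ ij.2 • convPow μ ij.1 := by
  have h : Commute (convRight μ) (c • 1) := (Commute.one_right _).smul_right c
  simp only [convPow_eq_convRight_pow, convRight_add_smul_dirac_zero, h.add_pow', smul_pow,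
    one_pow, mul_smul_comm, mul_one, LinearMap.sum_apply, LinearMap.smul_apply]

/-- An atom at zero does not change the compound Poisson measure. -/
theorem cPoisson_add_smul_dirac_zero (μ : Measure G) [IsFiniteMeasure μ] {c : ℝ≥0∞}
    (hc : c ≠ ∞) : cPoisson (μ + c • Measure.dirac 0) = cPoisson μ := by
  ext s hs
  rw [cPoisson_apply _ hs, cPoisson_apply _ hs]
  have hmass : ENNReal.ofReal (Real.exp (-((μ + c • Measure.dirac (0 : G)) Set.univ).toReal)) *
      ENNReal.ofReal (Real.exp c.toReal) = ENNReal.ofReal (Real.exp (-(μ Set.univ).toReal)) := by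
    rw [← ENNReal.ofReal_mul (Real.exp_nonneg _), ← Real.exp_add]
    simp [ENNReal.toReal_add (measure_ne_top μ _) hc]
  rw [← hmass]
  set w := ENNReal.ofReal (Real.exp (-((μ + c • Measure.dirac (0 : G)) Set.univ).toReal))
  have hterm : ∀ n : ℕ, w / (n.factorial : ℝ≥0∞) * convPow (μ + c • Measure.dirac 0) n s =
      ∑ ij ∈ Finset.HasAntidiagonal.antidiagonal n,
        w * (convPow μ ij.1 s / (ij.1.factorial : ℝ≥0∞)) * (c ^ ij.2 / (ij.2.factorial : ℝ≥0∞)) := fun n ↦ by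
    rw [convPow_add_smul_dirac_zero, Measure.finsetSum_apply, Finset.mul_sum]
    refine Finset.sum_congr rfl fun ij hij ↦ ?_
    obtain rfl := Finset.HasAntidiagonal.mem_antidiagonal.1 hij
    have hfac : ((ij.1 + ij.2).choose ij.1 : ℝ≥0∞) / ((ij.1 + ij.2).factorial : ℝ≥0∞) =
        (ij.1.factorial : ℝ≥0∞)⁻¹ * (ij.2.factorial : ℝ≥0∞)⁻¹ := by
      rw [← ENNReal.mul_inv (by simp [Nat.factorial_ne_zero]) (by simp),
        ENNReal.div_eq_inv_mul, ← Nat.add_choose_mul_factorial_mul_factorial,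
        ← Nat.choose_symm_add]
      push_cast
      have hb : (((ij.1 + ij.2).choose ij.1 : ℕ) : ℝ≥0∞) ≠ 0 := by
        exact_mod_cast (Nat.choose_pos (Nat.le_add_right _ _)).ne'
      rw [mul_assoc, ENNReal.mul_inv (Or.inl hb) (Or.inl (by simp)), mul_right_comm,
        ENNReal.inv_mul_cancel hb (by simp), one_mul]
    simp only [Measure.smul_apply, nsmul_eq_mul, smul_eq_mul]
    calc _ = w * (((ij.1 + ij.2).choose ij.1 : ℝ≥0∞) / ((ij.1 + ij.2).factorial : ℝ≥0∞)) *
          (c ^ ij.2 * convPow μ ij.1 s) := by simp only [div_eq_mul_inv]; ring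
      _ = _ := by rw [hfac]; simp only [div_eq_mul_inv]; ring
  simp only [hterm]
  rw [tsum_sum_antidiagonal_eq_tsum_tsum (fun i j ↦ w * (convPow μ i s / (i.factorial : ℝ≥0∞)) *
    (c ^ j / (j.factorial : ℝ≥0∞)))]
  refine tsum_congr fun i ↦ ?_
  rw [ENNReal.tsum_mul_left, ENNReal.tsum_pow_div_factorial hc]
  simp only [div_eq_mul_inv]
  ring

instance convPow.instSFinite (μ : Measure G) [SFinite μ] (n : ℕ) : SFinite (convPow μ n) := by
  induction n with
  | zero => exact inferInstanceAs (SFinite (Measure.dirac 0))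
  | succ n ih => exact inferInstanceAs (SFinite ((convPow μ n).conv μ))

theorem map_convPow (f : G →+ H) (hf : Measurable f) (μ : Measure G) [SFinite μ] (n : ℕ) :
    (convPow μ n).map f = convPow (μ.map f) n := by
  induction n with
  | zero => simp [convPow, Measure.map_dirac' hf]
  | succ n ih => rw [convPow, Measure.map_conv_addMonoidHom f hf, ih, convPow]

theorem map_cPoisson (f : G →+ H) (hf : Measurable f) (μ : Measure G) [SFinite μ] :
    (cPoisson μ).map f = cPoisson (μ.map f) := by
  rw [cPoisson, Measure.map_sum hf.aemeasurable, cPoisson]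
  simp only [Measure.map_smul, map_convPow f hf, Measure.map_apply hf MeasurableSet.univ,
    Set.preimage_univ]

end CompoundPoisson

theorem measurable_appr (n : ℕ) : Measurable fun x : ℤ_[p] ↦ x.appr n := by
  refine (IsLocallyConstant.continuous ?_).measurable
  rw [IsLocallyConstant.iff_eventually_eq]
  intro x
  have hopen : IsOpen {y : ℤ_[p] | ‖y - x‖ < (p : ℝ) ^ (-(n : ℤ) + 1)} :=
    isOpen_lt (by fun_prop) continuous_const
  have hp : (0 : ℝ) < p := by exact_mod_cast (Fact.out : p.Prime).pos
  filter_upwards [hopen.mem_nhds (by simp only [Set.mem_ofPred_eq, sub_self, norm_zero]; positivity)]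
    with y hy
  have hmem : y - x ∈ Ideal.span {(p : ℤ_[p]) ^ n} :=
    (PadicInt.norm_le_pow_iff_mem_span_pow _ n).1
      ((PadicInt.norm_le_pow_iff_norm_lt_pow_add_one _ _).2 hy)
  have h := PadicInt.zmod_congr_of_sub_mem_span n y (y.appr n) (x.appr n) (PadicInt.appr_spec n y)
    (by simpa using Ideal.add_mem _ hmem (PadicInt.appr_spec n x))
  exact Nat.ModEq.eq_of_lt_of_lt ((ZMod.natCast_eq_natCast_iff _ _ _).1 h)
    (PadicInt.appr_lt y n) (PadicInt.appr_lt x n)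

theorem measurable_padicDigit (j : ℕ) : Measurable fun x : ℤ_[p] ↦ padicDigit x j :=
  (measurable_from_top (f := fun m : ℕ ↦ ((m / p ^ j : ℕ) : ℤ))).comp (measurable_appr (j + 1))

theorem measure_padicDigit_eq_tsum (η : Measure ℤ_[p]) {n : ℕ} (ℓ : Fin (n + 1) → ℤ) :
    η {x : ℤ_[p] | ∀ i : Fin (n + 1), padicDigit x i = ℓ i} =
      ∑' m : ℤ, η {x : ℤ_[p] | ∀ i : Fin (n + 2), padicDigit x i =
        (Fin.snoc ℓ m : Fin (n + 2) → ℤ) i} := by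
  rw [← measure_iUnion]
  · congr 1
    ext x
    simp [Fin.forall_fin_succ' (n := n + 1)]
  · intro a b hab
    refine Set.disjoint_left.2 fun x ha hb ↦ hab ?_
    have := (ha (Fin.last _)).symm.trans (hb (Fin.last _))
    simpa using this
  · intro m
    simp only [Set.ofPred_forall]
    exact MeasurableSet.iInter fun i ↦ measurable_padicDigit i (MeasurableSet.singleton _)

/-- Forgetting the last coordinate, as an additive homomorphism. -/
def initHom (n : ℕ) : (Fin (n + 1) → ℤ) →+ (Fin n → ℤ) where
  toFun v i := v i.castSucc
  map_zero' := rfl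
  map_add' _ _ := rfl

theorem measurable_initHom (n : ℕ) : Measurable (initHom n) :=
  measurable_pi_lambda _ fun i ↦ measurable_pi_apply i.castSucc

theorem map_initHom_singleton {n : ℕ} (μ : Measure (Fin (n + 1) → ℤ)) (ℓ : Fin n → ℤ) :
    μ.map (initHom n) {ℓ} = ∑' m : ℤ, μ {(Fin.snoc ℓ m : Fin (n + 1) → ℤ)} := by
  rw [Measure.map_apply (measurable_initHom n) (MeasurableSet.singleton _), ← measure_iUnion]
  · congr 1
    ext v
    simp only [Set.mem_preimage, Set.mem_singleton_iff, Set.mem_iUnion]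
    constructor
    · rintro rfl
      exact ⟨v (Fin.last n), (Fin.snoc_init_self v).symm⟩
    · rintro ⟨m, rfl⟩
      exact Fin.init_snoc (α := fun _ ↦ ℤ) m ℓ
  · intro a b hab
    refine Set.disjoint_singleton.2 fun h ↦ hab ?_
    simpa using congrFun h (Fin.last n)
  · exact fun m ↦ MeasurableSet.singleton _

/-- For a Lévy measure `η` on `ℤ_p` and the induced finite measures `η_{n+1}` on `ℤ^{n+1}`
(`η_{n+1}({0}) = 0`, `η_{n+1}({ℓ}) = η({x : (x_0,…,x_n) = ℓ})` for `ℓ ≠ 0`, where the `x_j`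
are the `p`-adic digits), the compound Poisson measures are compatible:
`e(η_{n+2})({ℓ} × ℤ) = e(η_{n+1})({ℓ})` for every `n ≥ 0` and `ℓ ∈ ℤ^{n+1}`. -/
theorem stmt12 (η : Measure ℤ_[p]) (hη0 : η {0} = 0)
    (hηfin : ∀ r : ℕ, η {x : ℤ_[p] | ¬ (p : ℤ_[p]) ^ r ∣ x} < ⊤)
    (ν : (n : ℕ) → Measure (Fin (n + 1) → ℤ)) (hνfin : ∀ n, IsFiniteMeasure (ν n))
    (hν0 : ∀ n, ν n {(0 : Fin (n + 1) → ℤ)} = 0)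
    (hν : ∀ n, ∀ ℓ : Fin (n + 1) → ℤ, ℓ ≠ 0 →
      ν n {ℓ} = η {x : ℤ_[p] | ∀ i : Fin (n + 1), padicDigit x i = ℓ i}) :
    ∀ n : ℕ, ∀ ℓ : Fin (n + 1) → ℤ,
      cPoisson (ν (n + 1)) {v : Fin (n + 2) → ℤ | ∀ i : Fin (n + 1), v i.castSucc = ℓ i}
        = cPoisson (ν n) {ℓ} := by
  intro n ℓ
  have := hνfin n
  have := hνfin (n + 1)
  have hmap : (ν (n + 1)).map (initHom (n + 1)) =
      ν n + ((ν (n + 1)).map (initHom (n + 1)) {0}) • Measure.dirac 0 := by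
    refine Measure.ext_of_singleton fun k ↦ ?_
    rcases eq_or_ne k 0 with rfl | hk
    · simp [hν0]
    · have hsnoc : ∀ m : ℤ, (Fin.snoc k m : Fin (n + 2) → ℤ) ≠ 0 := fun m h ↦ hk <| by
        funext i
        simpa using congrFun h i.castSucc
      rw [map_initHom_singleton, tsum_congr fun m ↦ hν (n + 1) _ (hsnoc m),
        ← measure_padicDigit_eq_tsum, ← hν n k hk]
      simp [hk.symm]
  calc cPoisson (ν (n + 1)) {v : Fin (n + 2) → ℤ | ∀ i : Fin (n + 1), v i.castSucc = ℓ i}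
      = (cPoisson (ν (n + 1))).map (initHom (n + 1)) {ℓ} := by
        rw [Measure.map_apply (measurable_initHom _) (MeasurableSet.singleton _)]
        congr 1
        ext v
        exact funext_iff.symm
    _ = cPoisson (ν n) {ℓ} := by
        rw [map_cPoisson _ (measurable_initHom _), hmap,
          cPoisson_add_smul_dirac_zero _ (measure_ne_top _ _)]
end

section
/- Let p be a prime. The map φ : ℝ × ℤ^{ℤ≥1} → 𝕋^{ℤ≥0} defined by φ(y_0, y_1, y_2, …)_d = exp(i(y_0 + 2πy_1 + 2πy_2 p + ⋯ + 2πy_d p^{d−1})/p^d) takes values in the p-adic solenoid S_p, and it is a continuous surjective group homomorphism from the additive group ℝ × ℤ^{ℤ≥1} (product topology, ℤ discrete) onto S_p. Moreover, the map τ : S_p → ℝ × ℤ^{ℤ≥1} defined by τ(x) = (arg x_0, (p·arg x_1 − arg x_0)/(2π), (p·arg x_2 − arg x_1)/(2π), …) is well defined (each coordinate after the first is an integer) and satisfies φ(τ(a)) = a for every a ∈ S_p. -/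
open MeasureTheory Real Complex

/-- The `p`-adic solenoid, as a subgroup of the product `𝕋^{ℕ}` of circle groups:
`S_p = {y : y_j = y_{j+1}^p for all j}`. -/
noncomputable def Sp (p : ℕ) : Subgroup (ℕ → Circle) where
  carrier := {y | ∀ j : ℕ, y j = y (j + 1) ^ p}
  one_mem' := by intro j; simp
  mul_mem' := by
    intro a b ha hb j
    simp only [Pi.mul_apply, mul_pow]
    rw [← ha j, ← hb j]
  inv_mem' := by
    intro a ha j
    simp only [Pi.inv_apply, inv_pow]
    rw [← ha j]

/-- The map `φ : ℝ × ℤ^{ℕ} → 𝕋^{ℕ}`,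
`φ(y_0, y_1, y_2, …)_d = exp (i(y_0 + 2πy_1 + 2πy_2 p + ⋯ + 2πy_d p^{d−1})/p^d)`
(here the second component of `y` lists `y_1, y_2, …`). -/
noncomputable def phi (p : ℕ) (y : ℝ × (ℕ → ℤ)) : ℕ → Circle := fun d =>
  Circle.exp ((y.1 + 2 * π * ∑ k ∈ Finset.range d, (y.2 k : ℝ) * (p : ℝ) ^ k) / (p : ℝ) ^ d)

/-- The map `τ : S_p → ℝ × ℤ^{ℕ}`,
`τ(x) = (arg x_0, (p·arg x_1 − arg x_0)/(2π), (p·arg x_2 − arg x_1)/(2π), …)`. -/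
noncomputable def tau (p : ℕ) (x : ℕ → Circle) : ℝ × (ℕ → ℤ) :=
  (Complex.arg (x 0 : ℂ),
    fun k => round ((p * Complex.arg (x (k + 1) : ℂ) - Complex.arg (x k : ℂ)) / (2 * π)))

lemma phi_mem_Sp (p : ℕ) (hp : p ≠ 0) (y : ℝ × (ℕ → ℤ)) : phi p y ∈ Sp p := by
  intro j
  have hp' : (p : ℝ) ≠ 0 := Nat.cast_ne_zero.mpr hp
  simp only [phi]
  rw [← Circle.exp_nsmul, eq_comm, Circle.exp_eq_exp]
  refine ⟨y.2 j, ?_⟩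
  rw [Finset.sum_range_succ, nsmul_eq_mul]
  field_simp
  ring

lemma continuous_phi (p : ℕ) : Continuous (phi p) := by
  refine continuous_pi fun d => Circle.exp.continuous.comp ?_
  have h (k : ℕ) : Continuous fun y : ℝ × (ℕ → ℤ) => (y.2 k : ℝ) :=
    continuous_of_discreteTopology.comp ((continuous_apply k).comp continuous_snd)
  fun_prop

lemma phi_add (p : ℕ) (y z : ℝ × (ℕ → ℤ)) : phi p (y + z) = phi p y * phi p z := by
  ext1 d
  simp only [phi, Pi.mul_apply, ← Circle.exp_add, Prod.fst_add, Prod.snd_add, Pi.add_apply,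
    Int.cast_add, add_mul, Finset.sum_add_distrib]
  congr 1
  ring

lemma tau_snd_mul_two_pi (p : ℕ) {a : ℕ → Circle} (ha : a ∈ Sp p) (k : ℕ) :
    ((tau p a).2 k : ℝ) * (2 * π) =
      p * Complex.arg (a (k + 1) : ℂ) - Complex.arg (a k : ℂ) := by
  have h : Circle.exp (p * Complex.arg (a (k + 1) : ℂ)) = Circle.exp (Complex.arg (a k : ℂ)) := by
    rw [← nsmul_eq_mul, Circle.exp_nsmul, Circle.exp_arg, Circle.exp_arg, ← ha k]
  obtain ⟨m, hm⟩ := Circle.exp_eq_exp.mp h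
  have hm' : (p * Complex.arg (a (k + 1) : ℂ) - Complex.arg (a k : ℂ)) / (2 * π) = m := by
    rw [hm]
    field_simp
    ring
  simp only [tau, hm', round_intCast]
  rw [hm]
  ring

lemma phi_tau (p : ℕ) (hp : p ≠ 0) {a : ℕ → Circle} (ha : a ∈ Sp p) : phi p (tau p a) = a := by
  have hp' : (p : ℝ) ≠ 0 := Nat.cast_ne_zero.mpr hp
  have h (d : ℕ) : (tau p a).1 +
      2 * π * ∑ k ∈ Finset.range d, ((tau p a).2 k : ℝ) * (p : ℝ) ^ k =
        Complex.arg (a d : ℂ) * (p : ℝ) ^ d := by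
    induction d with
    | zero => simp [tau]
    | succ d ih =>
      rw [Finset.sum_range_succ]
      linear_combination ih + (p : ℝ) ^ d * tau_snd_mul_two_pi p ha d
  ext1 d
  rw [phi, h, mul_div_cancel_right₀ _ (pow_ne_zero d hp'), Circle.exp_arg]

/-- `φ` maps `ℝ × ℤ^{ℕ}` into the `p`-adic solenoid `S_p` and is a continuous surjective
group homomorphism onto `S_p`; moreover `τ : S_p → ℝ × ℤ^{ℕ}` is well defined (each
coordinate after the first is an integer) and is a section of `φ`: `φ(τ(a)) = a` for every
`a ∈ S_p`. -/
theorem stmt14 (p : ℕ) (hp : p.Prime) :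
    (∀ y : ℝ × (ℕ → ℤ), phi p y ∈ Sp p) ∧
    Continuous (phi p) ∧
    (∀ s ∈ Sp p, ∃ y : ℝ × (ℕ → ℤ), phi p y = s) ∧
    (∀ y z : ℝ × (ℕ → ℤ), phi p (y + z) = phi p y * phi p z) ∧
    (∀ a ∈ Sp p, ∀ k : ℕ,
      ((tau p a).2 k : ℝ) * (2 * π) = p * Complex.arg (a (k + 1) : ℂ) - Complex.arg (a k : ℂ)) ∧
    (∀ a ∈ Sp p, phi p (tau p a) = a) := by
  exact ⟨phi_mem_Sp p hp.ne_zero, continuous_phi p,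
    fun s hs => ⟨tau p s, phi_tau p hp.ne_zero hs⟩, phi_add p,
    fun _ ha => tau_snd_mul_two_pi p ha, fun _ ha => phi_tau p hp.ne_zero ha⟩
end

section
/- Let p be a prime, a ∈ S_p, b ≥ 0, and let η be a Lévy measure on S_p (η({e}) = 0, ∫_{S_p}(arg y_0)² dη(y) < ∞, and η finite outside every neighbourhood of e). For n ≥ 0 let η_{n+1} be the Lévy measure on ℝ × ℤⁿ defined by η_{n+1}({0}) = 0 and η_{n+1}(B × {ℓ}) = η({x ∈ S_p : τ(x)_0 ∈ B, (τ(x)_1, …, τ(x)_n) = ℓ}) for Borel B ⊆ ℝ and ℓ ∈ ℤⁿ with 0 ∉ B × {ℓ}. Let X_0 be a real random variable with the normal distribution N(0, b), independent of a sequence of random variables Y_0 (real-valued), Y_1, Y_2, … (integer-valued) such that for every n ≥ 0 and all y ∈ ℝ, z_1, …, z_n ∈ 𝕋, E[e^{iyY_0} z_1^{Y_1} ⋯ z_n^{Y_n}] = exp(∫_{ℝ×ℤⁿ} (e^{iyx} z_1^{ℓ_1} ⋯ z_n^{ℓ_n} − 1 − iy h(x)) dη_{n+1}(x, ℓ_1,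 …, ℓ_n)). Then for every d ≥ 0 and ℓ ∈ ℤ, the S_p-valued random element φ(τ(a)_0 + X_0 + Y_0, τ(a)_1 + Y_1, τ(a)_2 + Y_2, …) satisfies E[φ(τ(a) + (X_0 + Y_0, Y_1, Y_2, …))_d^ℓ] = a_d^ℓ · exp(−bℓ²/(2p^{2d})) · exp(∫_{S_p} (y_d^ℓ − 1 − iℓ h(arg y_0)/p^d) dη(y)). -/
open MeasureTheory Real Complex ENNReal ProbabilityTheory

/-- The function `h` used as (the kernel of) the local inner product. -/
noncomputable def hFun (x : ℝ) : ℝ :=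
  if x < -π then 0
  else if π ≤ x then 0
  else if x < -(π / 2) then -x - π
  else if x < π / 2 then x
  else -x + π

theorem measurable_circle_coe : Measurable fun z : Circle => (z : ℂ) := by
  have : Continuous fun z : Circle => (z : ℂ) := by fun_prop
  exact this.measurable

theorem measurable_coe_circleExp : Measurable fun x : ℝ => (Circle.exp x : ℂ) := by
  have : Continuous fun x : ℝ => (Circle.exp x : ℂ) := by fun_prop
  exact this.measurable

theorem measurable_hFun : Measurable hFun := by
  unfold hFun
  refine Measurable.ite measurableSet_Iio measurable_const ?_
  refine Measurable.ite measurableSet_Ici measurable_const ?_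
  refine Measurable.ite measurableSet_Iio (by fun_prop) ?_
  exact Measurable.ite measurableSet_Iio (by fun_prop) (by fun_prop)

theorem hFun_zero : hFun 0 = 0 := by
  have := Real.pi_pos
  unfold hFun
  rw [if_neg (by linarith), if_neg (by linarith), if_neg (by linarith), if_pos (by linarith)]

/-- The argument of the `k`-th coordinate of a point of the solenoid. -/
noncomputable def solenoidArg {p : ℕ} (k : ℕ) (y : ↥(Sp p)) : ℝ :=
  Complex.arg (((y : ℕ → Circle) k : Circle) : ℂ)

/-- The integer coordinates of the map `τ` (with indices shifted by one). -/
noncomputable def solenoidDigit {p : ℕ} (k : ℕ) (y : ↥(Sp p)) : ℤ :=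
  ⌊(p * solenoidArg (k + 1) y - solenoidArg k y) / (2 * π)⌋

/-- The truncation of the map `τ` to `ℝ × ℤⁿ`. -/
noncomputable def solenoidCoord {p : ℕ} (n : ℕ) (y : ↥(Sp p)) : ℝ × (Fin n → ℤ) :=
  (solenoidArg 0 y, fun i => solenoidDigit i y)

theorem exp_solenoidArg {p : ℕ} (k : ℕ) (y : ↥(Sp p)) :
    Circle.exp (solenoidArg k y) = (y : ℕ → Circle) k :=
  Circle.exp_arg _

theorem solenoidDigit_mul {p : ℕ} (k : ℕ) (y : ↥(Sp p)) :
    (solenoidDigit k y : ℝ) * (2 * π) = p * solenoidArg (k + 1) y - solenoidArg k y := by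
  obtain ⟨m, hm⟩ : ∃ m : ℤ, p * solenoidArg (k + 1) y = solenoidArg k y + m * (2 * π) := by
    rw [← Circle.exp_eq_exp, Circle.exp_natCast_mul, exp_solenoidArg, exp_solenoidArg]
    exact (y.2 k).symm
  have h : (p * solenoidArg (k + 1) y - solenoidArg k y) / (2 * π) = m := by
    rw [hm]
    field_simp
    ring
  rw [solenoidDigit, h, Int.floor_intCast, hm]
  ring

theorem measurable_solenoidArg {p : ℕ} (k : ℕ) :
    Measurable (solenoidArg k : ↥(Sp p) → ℝ) := by
  exact Complex.measurable_arg.comp (measurable_circle_coe.comp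
    ((measurable_pi_apply k).comp measurable_subtype_coe))

theorem measurable_solenoidCoord {p : ℕ} (n : ℕ) :
    Measurable (solenoidCoord n : ↥(Sp p) → ℝ × (Fin n → ℤ)) := by
  refine (measurable_solenoidArg 0).prodMk (measurable_pi_lambda _ fun i => ?_)
  exact Int.measurable_floor.comp
    ((((measurable_solenoidArg _).const_mul _).sub (measurable_solenoidArg _)).div_const _)

theorem arg_add_sum_solenoidDigit {p : ℕ} (d : ℕ) (y : ↥(Sp p)) :
    solenoidArg 0 y + 2 * π * ∑ k ∈ Finset.range d, (solenoidDigit k y : ℝ) * (p : ℝ) ^ k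
      = (p : ℝ) ^ d * solenoidArg d y := by
  induction d with
  | zero => simp
  | succ d ih =>
    rw [Finset.sum_range_succ]
    linear_combination ih + (p : ℝ) ^ d * solenoidDigit_mul d y

theorem exp_solenoidCoord {p : ℕ} (hp : p ≠ 0) (d : ℕ) (ℓ : ℤ) (y : ↥(Sp p)) :
    Circle.exp (ℓ * ((solenoidArg 0 y
      + 2 * π * ∑ k ∈ Finset.range d, (solenoidDigit k y : ℝ) * (p : ℝ) ^ k) / (p : ℝ) ^ d))
      = (y : ℕ → Circle) d ^ ℓ := by
  rw [arg_add_sum_solenoidDigit, mul_div_cancel_left₀ _ (by positivity), Circle.exp_intCast_mul,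
    exp_solenoidArg]

/-- A character of `ℝ × ℤᵈ` expressed through a single exponential. -/
theorem exp_mul_prod_zpow (p d : ℕ) (ℓ : ℤ) (x : ℝ) (m : ℕ → ℤ) :
    Complex.exp (Complex.I * ((ℓ / (p : ℝ) ^ d : ℝ) : ℂ) * x)
      * ∏ k : Fin d, ((Circle.exp (ℓ * (2 * π * (p : ℝ) ^ (k : ℕ) / (p : ℝ) ^ d)) : Circle) : ℂ)
          ^ (m k)
      = (Circle.exp (ℓ * ((x + 2 * π * ∑ k ∈ Finset.range d, (m k : ℝ) * (p : ℝ) ^ k)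
          / (p : ℝ) ^ d)) : ℂ) := by
  rw [Fin.prod_univ_eq_prod_range
    (fun k => ((Circle.exp (ℓ * (2 * π * (p : ℝ) ^ k / (p : ℝ) ^ d)) : Circle) : ℂ) ^ (m k)) d]
  simp only [← Circle.coe_zpow, ← Circle.exp_intCast_mul]
  simp only [Circle.coe_exp]
  rw [← Complex.exp_sum, ← Complex.exp_add]
  congr 1
  push_cast
  rw [add_div, mul_add, add_mul, Finset.mul_sum, Finset.sum_div, Finset.mul_sum, Finset.sum_mul]
  congr 1
  · ring
  · exact Finset.sum_congr rfl fun k _ => by ring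

/-- A measure on `ℝ × ℤⁿ` with no mass at `0` is determined by the fibres away from `0`. -/
theorem eq_restrict_compl_zero {n : ℕ} (μ κ : Measure (ℝ × (Fin n → ℤ))) (hμ : μ {0} = 0)
    (h : ∀ B : Set ℝ, MeasurableSet B → ∀ ℓ : Fin n → ℤ, ¬((0 : ℝ) ∈ B ∧ ℓ = 0) →
      μ (B ×ˢ {ℓ}) = κ (B ×ˢ {ℓ})) :
    μ = κ.restrict {0}ᶜ := by
  have hμr : μ = μ.restrict {0}ᶜ :=
    (Measure.restrict_eq_self_of_ae_mem (by simpa [ae_iff] using hμ)).symm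
  rw [hμr]
  ext A hA
  rw [Measure.restrict_apply hA, Measure.restrict_apply hA]
  set C := A ∩ ({0} : Set (ℝ × (Fin n → ℤ)))ᶜ with hC
  have hCm : MeasurableSet C := hA.inter (measurableSet_singleton _).compl
  have hdec : C = ⋃ ℓ : Fin n → ℤ, ((fun x : ℝ => (x, ℓ)) ⁻¹' C) ×ˢ {ℓ} := by
    ext ⟨x, m⟩
    simp
  have hm : ∀ ℓ : Fin n → ℤ, MeasurableSet ((fun x : ℝ => (x, ℓ)) ⁻¹' C) := fun ℓ =>
    measurable_prodMk_right hCm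
  have hdisj : Pairwise (Function.onFun Disjoint
      fun ℓ : Fin n → ℤ => ((fun x : ℝ => (x, ℓ)) ⁻¹' C) ×ˢ ({ℓ} : Set (Fin n → ℤ))) := by
    intro a b hab
    refine Set.disjoint_left.2 fun q hq hq' => hab ?_
    exact (Set.mem_singleton_iff.1 hq.2).symm.trans (Set.mem_singleton_iff.1 hq'.2)
  have hms := fun ℓ : Fin n → ℤ => (hm ℓ).prod (measurableSet_singleton ℓ)
  rw [hdec, measure_iUnion hdisj hms, measure_iUnion hdisj hms]
  refine tsum_congr fun ℓ => h _ (hm ℓ) ℓ ?_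
  rintro ⟨h0, rfl⟩
  exact h0.2 rfl

/-- Integrals against the Lévy measures on `ℝ × ℤⁿ` of functions vanishing at `0` are integrals
against the Lévy measure on the solenoid. -/
theorem integral_eq_integral_solenoidCoord {p n : ℕ} (η : Measure ↥(Sp p))
    (μ : Measure (ℝ × (Fin n → ℤ))) (hμ : μ {0} = 0)
    (h : ∀ B : Set ℝ, MeasurableSet B → ∀ ℓ : Fin n → ℤ, ¬((0 : ℝ) ∈ B ∧ ℓ = 0) →
      μ (B ×ˢ ({ℓ} : Set (Fin n → ℤ)))
        = η {y : ↥(Sp p) | Complex.arg (((y : ℕ → Circle) 0 : Circle) : ℂ) ∈ B ∧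
            ∀ i : Fin n, (ℓ i : ℝ) * (2 * π)
              = p * Complex.arg (((y : ℕ → Circle) (i + 1) : Circle) : ℂ)
                - Complex.arg (((y : ℕ → Circle) i : Circle) : ℂ)})
    {F : ℝ × (Fin n → ℤ) → ℂ} (hF : Measurable F) (hF0 : F 0 = 0) :
    ∫ q, F q ∂μ = ∫ y, F (solenoidCoord n y) ∂η := by
  have hμη : μ = (η.map (solenoidCoord n)).restrict {0}ᶜ := by
    refine eq_restrict_compl_zero _ _ hμ fun B hB ℓ hℓ => ?_
    rw [h B hB ℓ hℓ, Measure.map_apply (measurable_solenoidCoord n)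
      (hB.prod (measurableSet_singleton ℓ))]
    congr 1
    ext y
    refine and_congr Iff.rfl ?_
    rw [Set.mem_singleton_iff, funext_iff]
    refine forall_congr' fun i => ?_
    change (ℓ i : ℝ) * (2 * π) = p * solenoidArg (i + 1) y - solenoidArg i y
      ↔ solenoidDigit i y = ℓ i
    rw [← solenoidDigit_mul, mul_left_inj' (by positivity), Int.cast_inj, eq_comm]
  rw [hμη, setIntegral_eq_integral_of_forall_compl_eq_zero, integral_map
    (measurable_solenoidCoord n).aemeasurable hF.aestronglyMeasurable]
  intro q hq
  rw [not_not.1 hq, hF0]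

theorem integral_circleExp_eq_of_map_gaussianReal {Ω : Type*} [MeasurableSpace Ω] {P : Measure Ω}
    {X : Ω → ℝ} (hX : Measurable X) {b : NNReal} (h : Measure.map X P = gaussianReal 0 b)
    (t : ℝ) :
    ∫ ω, (Circle.exp (t * X ω) : ℂ) ∂P = Real.exp (-(b : ℝ) * t ^ 2 / 2) := by
  have hm : Measurable fun x : ℝ => (Circle.exp (t * x) : ℂ) :=
    measurable_coe_circleExp.comp (measurable_id.const_mul t)
  have := charFun_gaussianReal (μ := 0) (v := b) t
  rw [← h, charFun_apply_real, integral_map hX.aemeasurable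
    (by simpa [Circle.coe_exp] using hm.aestronglyMeasurable)] at this
  simp only [Circle.coe_exp, Complex.ofReal_mul]
  rw [this, Complex.ofReal_exp]
  congr 1
  push_cast
  ring

/-- Representation of a weakly infinitely divisible measure without idempotent factor on the
`p`-adic solenoid: if `X_0 ∼ N(0,b)` is independent of `(Y_0, Y_1, …)`, where for each `n` the
vector `(Y_0, …, Y_n)` has the generalized Poisson distribution `π_{η_{n+1}, g_{ℝ×ℤⁿ}}`
(expressed through its characteristic function) associated with the measures `η_{n+1}` induced
from a Lévy measure `η` on `S_p` via `τ`, then the Fourier coefficients of the `S_p`-valued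
random element `φ(τ(a)_0 + X_0 + Y_0, τ(a)_1 + Y_1, τ(a)_2 + Y_2, …)` are
`a_d^ℓ · exp (−bℓ²/(2p^{2d})) · exp (∫ (y_d^ℓ − 1 − iℓ h(arg y_0)/p^d) dη(y))`. -/
theorem stmt18 (p : ℕ) (hp : p.Prime)
    {Ω : Type*} [MeasurableSpace Ω] (P : Measure Ω) [IsProbabilityMeasure P]
    (a : ↥(Sp p)) (b : NNReal) (η : Measure ↥(Sp p))
    (hη1 : η {(1 : ↥(Sp p))} = 0)
    (hηnbhd : ∀ U : Set ↥(Sp p), MeasurableSet U → U ∈ nhds (1 : ↥(Sp p)) → η Uᶜ < ⊤)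
    (hηarg : ∫⁻ y : ↥(Sp p),
        ENNReal.ofReal ((Complex.arg (((y : ℕ → Circle) 0 : Circle) : ℂ)) ^ 2) ∂η < ⊤)
    (ν : (n : ℕ) → Measure (ℝ × (Fin n → ℤ)))
    (hν0 : ∀ n, ν n {(0 : ℝ × (Fin n → ℤ))} = 0)
    (hν : ∀ n, ∀ B : Set ℝ, MeasurableSet B → ∀ ℓ : Fin n → ℤ, ¬((0 : ℝ) ∈ B ∧ ℓ = 0) →
      ν n (B ×ˢ ({ℓ} : Set (Fin n → ℤ)))
        = η {y : ↥(Sp p) | Complex.arg (((y : ℕ → Circle) 0 : Circle) : ℂ) ∈ B ∧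
            ∀ i : Fin n, (ℓ i : ℝ) * (2 * π)
              = p * Complex.arg (((y : ℕ → Circle) (i + 1) : Circle) : ℂ)
                - Complex.arg (((y : ℕ → Circle) i : Circle) : ℂ)})
    (X₀ Y₀ : Ω → ℝ) (Y : ℕ → Ω → ℤ)
    (hX₀meas : Measurable X₀) (hY₀meas : Measurable Y₀) (hYmeas : ∀ k, Measurable (Y k))
    (hIndep : IndepFun X₀ (fun ω => ((Y₀ ω, fun k : ℕ => Y k ω) : ℝ × (ℕ → ℤ))) P)
    (hX₀ : Measure.map X₀ P = gaussianReal 0 b)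
    (hY : ∀ n : ℕ, ∀ y : ℝ, ∀ z : Fin n → Circle,
      (∫ ω, Complex.exp (Complex.I * y * Y₀ ω) * ∏ k : Fin n, ((z k : ℂ)) ^ (Y k ω) ∂P)
        = Complex.exp (∫ q : ℝ × (Fin n → ℤ),
            (Complex.exp (Complex.I * y * q.1) * ∏ k : Fin n, ((z k : ℂ)) ^ (q.2 k)
              - 1 - Complex.I * y * hFun q.1) ∂(ν n))) :
    ∀ d : ℕ, ∀ ℓ : ℤ,
      (∫ ω, ((Circle.exp
          ((Complex.arg (((a : ℕ → Circle) 0 : Circle) : ℂ) + X₀ ω + Y₀ ω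
            + 2 * π * ∑ k ∈ Finset.range d,
                (((p * Complex.arg (((a : ℕ → Circle) (k + 1) : Circle) : ℂ)
                    - Complex.arg (((a : ℕ → Circle) k : Circle) : ℂ)) / (2 * π))
                  + (Y k ω : ℝ)) * (p : ℝ) ^ k)
            / (p : ℝ) ^ d) : ℂ)) ^ ℓ ∂P)
        = (((a : ℕ → Circle) d : Circle) : ℂ) ^ ℓ
            * Real.exp (-(b : ℝ) * (ℓ : ℝ) ^ 2 / (2 * (p : ℝ) ^ (2 * d)))
            * Complex.exp (∫ y : ↥(Sp p),
                ((((y : ℕ → Circle) d : Circle) : ℂ) ^ ℓ - 1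
                  - Complex.I * ℓ * hFun (Complex.arg (((y : ℕ → Circle) 0 : Circle) : ℂ))
                      / (p : ℝ) ^ d) ∂η) := by
  intro d ℓ
  have hp0 : (p : ℝ) ^ d ≠ 0 := pow_ne_zero _ (Nat.cast_ne_zero.2 hp.ne_zero)
  set G : ℝ × (ℕ → ℤ) → ℂ := fun q =>
    (Circle.exp (ℓ * ((q.1 + 2 * π * ∑ k ∈ Finset.range d, (q.2 k : ℝ) * (p : ℝ) ^ k)
      / (p : ℝ) ^ d)) : ℂ) with hG
  have hcast : Measurable fun n : ℤ => (n : ℝ) := measurable_from_top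
  have hGm : Measurable G := by
    refine measurable_coe_circleExp.comp
      (((measurable_fst.add (Measurable.const_mul ?_ _)).div_const _).const_mul _)
    exact Finset.measurable_sum _ fun k _ =>
      (hcast.comp ((measurable_pi_apply k).comp measurable_snd)).mul_const _
  have hsplit : ∀ ω, ((Circle.exp
          ((Complex.arg (((a : ℕ → Circle) 0 : Circle) : ℂ) + X₀ ω + Y₀ ω
            + 2 * π * ∑ k ∈ Finset.range d,
                (((p * Complex.arg (((a : ℕ → Circle) (k + 1) : Circle) : ℂ)
                    - Complex.arg (((a : ℕ → Circle) k : Circle) : ℂ)) / (2 * π))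
                  + (Y k ω : ℝ)) * (p : ℝ) ^ k)
            / (p : ℝ) ^ d) : ℂ)) ^ ℓ
      = (((a : ℕ → Circle) d : Circle) : ℂ) ^ ℓ
        * ((Circle.exp ((ℓ / (p : ℝ) ^ d) * X₀ ω) : ℂ) * G (Y₀ ω, fun k => Y k ω)) := by
    intro ω
    have hdig : ∀ k, (p * Complex.arg (((a : ℕ → Circle) (k + 1) : Circle) : ℂ)
        - Complex.arg (((a : ℕ → Circle) k : Circle) : ℂ)) / (2 * π) = solenoidDigit k a := by
      intro k
      rw [div_eq_iff (by positivity), solenoidDigit_mul]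
      rfl
    simp only [hdig, hG, ← Circle.coe_zpow, ← Circle.coe_mul, ← Circle.exp_intCast_mul,
      ← exp_solenoidCoord hp.ne_zero d ℓ a, ← Circle.exp_add, add_mul, Finset.sum_add_distrib]
    congr 2
    simp only [solenoidArg]
    ring
  have hchar : ∫ ω, G (Y₀ ω, fun k => Y k ω) ∂P
      = Complex.exp (∫ y : ↥(Sp p),
          ((((y : ℕ → Circle) d : Circle) : ℂ) ^ ℓ - 1
            - Complex.I * ℓ * hFun (Complex.arg (((y : ℕ → Circle) 0 : Circle) : ℂ))
                / (p : ℝ) ^ d) ∂η) := by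
    have hYd := hY d (ℓ / (p : ℝ) ^ d)
      (fun k => Circle.exp (ℓ * (2 * π * (p : ℝ) ^ (k : ℕ) / (p : ℝ) ^ d)))
    rw [integral_congr_ae (.of_forall fun ω =>
      exp_mul_prod_zpow p d ℓ (Y₀ ω) (fun k => Y k ω))] at hYd
    rw [hYd, integral_eq_integral_solenoidCoord η (ν d) (hν0 d) (hν d)]
    · congr 2
      ext y
      have hy := exp_mul_prod_zpow p d ℓ (solenoidArg 0 y) (fun k => solenoidDigit k y)
      rw [exp_solenoidCoord hp.ne_zero, Circle.coe_zpow] at hy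
      simp only [solenoidCoord]
      rw [hy]
      change _ - _ - _ = _ - _ - Complex.I * ℓ * hFun (solenoidArg 0 y) / (p : ℝ) ^ d
      push_cast
      ring
    · refine (Measurable.mul ?_ ?_).sub_const _ |>.sub ?_
      · exact Complex.measurable_exp.comp
          ((Complex.measurable_ofReal.comp measurable_fst).const_mul _)
      · exact Finset.measurable_prod _ fun k _ =>
          (measurable_from_top (f := fun n : ℤ => _)).comp
            ((measurable_pi_apply k).comp measurable_snd)
      · exact (Complex.measurable_ofReal.comp (measurable_hFun.comp measurable_fst)).const_mul _
    · simp [hFun_zero]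
  simp only [hsplit]
  rw [integral_const_mul, hIndep.integral_fun_comp_mul_comp
    (f := fun x => (Circle.exp ((ℓ / (p : ℝ) ^ d) * x) : ℂ)) hX₀meas.aemeasurable
    (hY₀meas.prodMk (measurable_pi_lambda _ hYmeas)).aemeasurable
    (measurable_coe_circleExp.comp (measurable_id.const_mul _)).aestronglyMeasurable hGm.aestronglyMeasurable,
    integral_circleExp_eq_of_map_gaussianReal hX₀meas hX₀, hchar, ← mul_assoc]
  congr 4
  rw [pow_mul']
  field_simp
end
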